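/- For σ > 0, let G_σ be the Gaussian measure on ℝ with mean 0 and variance σ² conditioned on (i.e. restricted and renormalised to) the interval [−σ², σ²]. Then the function σ ↦ ∫∫∫ exp(−(x−y)²/2)·exp(−(y−z)²/2)·exp(−(z−x)²/2) dG_σ(x) dG_σ(y) dG_σ(z) is Θ(σ^{−2}) as σ → ∞; that is, there exist constants 0 < c ≤ C and σ₀ such that for all σ ≥ σ₀ the triple integral lies between c·σ^{−2} and C·σ^{−2}. -/

import Mathlib

open MeasureTheory ProbabilityTheory

/-- The Gaussian measure with mean `0` and variance `σ²`, conditioned (restricted and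
renormalised) to the interval `[-σ², σ²]`. -/
noncomputable def truncGauss (σ : ℝ) : Measure ℝ :=
  (gaussianReal 0 (Real.toNNReal (σ ^ 2)))[|Set.Icc (-σ ^ 2) (σ ^ 2)]

/-- The integrand `f(x,y) f(y,z) f(z,x)` of the triangle density for `f(x,y) = exp(−(x−y)²/2)`. -/
noncomputable def rbfTriangle (x y z : ℝ) : ℝ :=
  Real.exp (-(x - y) ^ 2 / 2) * Real.exp (-(y - z) ^ 2 / 2) * Real.exp (-(z - x) ^ 2 / 2)

lemma exp_neg_sq_div_two_le_one (t : ℝ) : Real.exp (-t ^ 2 / 2) ≤ 1 :=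
  Real.exp_le_one_iff.2 (by nlinarith [sq_nonneg t])

lemma rbfTriangle_nonneg (x y z : ℝ) : 0 ≤ rbfTriangle x y z := by
  unfold rbfTriangle; positivity

lemma rbfTriangle_le_mul (x y z : ℝ) :
    rbfTriangle x y z ≤ Real.exp (-(x - y) ^ 2 / 2) * Real.exp (-(y - z) ^ 2 / 2) :=
  mul_le_of_le_one_right (by positivity) (exp_neg_sq_div_two_le_one _)

lemma rbfTriangle_le_one (x y z : ℝ) : rbfTriangle x y z ≤ 1 :=
  (rbfTriangle_le_mul x y z).trans <|
    mul_le_one₀ (exp_neg_sq_div_two_le_one _) (by positivity) (exp_neg_sq_div_two_le_one _)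

lemma exp_neg_three_halves_le_rbfTriangle {x y z : ℝ} (hy : y ∈ Set.Icc x (x + 1))
    (hz : z ∈ Set.Icc x (x + 1)) : Real.exp (-(3 / 2)) ≤ rbfTriangle x y z := by
  obtain ⟨hy0, hy1⟩ := hy
  obtain ⟨hz0, hz1⟩ := hz
  rw [rbfTriangle, ← Real.exp_add, ← Real.exp_add, Real.exp_le_exp]
  have h₁ : (x - y) ^ 2 ≤ 1 := by rw [sq_le_one_iff_abs_le_one, abs_le]; constructor <;> linarith
  have h₂ : (y - z) ^ 2 ≤ 1 := by rw [sq_le_one_iff_abs_le_one, abs_le]; constructor <;> linarith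
  have h₃ : (z - x) ^ 2 ≤ 1 := by rw [sq_le_one_iff_abs_le_one, abs_le]; constructor <;> linarith
  linarith

lemma continuous_rbfTriangle :
    Continuous fun p : (ℝ × ℝ) × ℝ ↦ rbfTriangle p.1.1 p.1.2 p.2 := by
  unfold rbfTriangle; fun_prop

lemma integrable_of_nonneg_of_le_one {μ : Measure ℝ} [IsFiniteMeasure μ] {f : ℝ → ℝ}
    (hf : StronglyMeasurable f) (h0 : ∀ x, 0 ≤ f x) (h1 : ∀ x, f x ≤ 1) : Integrable f μ :=
  .of_bound hf.aestronglyMeasurable 1 (.of_forall fun x ↦ by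
    rw [Real.norm_of_nonneg (h0 x)]; exact h1 x)

lemma integral_le_one_of_nonneg_of_le_one {μ : Measure ℝ} [IsProbabilityMeasure μ] {f : ℝ → ℝ}
    (h0 : ∀ x, 0 ≤ f x) (h1 : ∀ x, f x ≤ 1) : ∫ x, f x ∂μ ≤ 1 := by
  simpa using integral_mono_of_nonneg (μ := μ) (.of_forall h0) (integrable_const 1) (.of_forall h1)

lemma mul_measureReal_le_integral {μ : Measure ℝ} [IsFiniteMeasure μ] {f : ℝ → ℝ} {c : ℝ}
    {A : Set ℝ} (hf : Integrable f μ) (h0 : ∀ x, 0 ≤ f x) (hc : 0 ≤ c) (hA : ∀ x ∈ A, c ≤ f x) :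
    c * μ.real A ≤ ∫ x, f x ∂μ :=
  (mul_le_mul_of_nonneg_left (measureReal_mono hA) hc).trans
    (mul_meas_ge_le_integral_of_nonneg (.of_forall h0) hf c)

/-- Lower bound for the triangle integral of a probability measure which charges every unit
interval starting in `A`. -/
lemma le_integral_rbfTriangle {μ : Measure ℝ} [IsProbabilityMeasure μ] {A : Set ℝ} {b : ℝ}
    (hb : 0 ≤ b) (hA : ∀ x ∈ A, b ≤ μ.real (Set.Icc x (x + 1))) :
    Real.exp (-(3 / 2)) * b ^ 2 * μ.real A ≤ ∫ x, ∫ y, ∫ z, rbfTriangle x y z ∂μ ∂μ ∂μ := by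
  have hm₂ : StronglyMeasurable fun p : ℝ × ℝ ↦ ∫ z, rbfTriangle p.1 p.2 z ∂μ :=
    continuous_rbfTriangle.stronglyMeasurable.integral_prod_right
  have hm₁ : StronglyMeasurable fun x : ℝ ↦ ∫ y, ∫ z, rbfTriangle x y z ∂μ ∂μ :=
    hm₂.integral_prod_right
  have h0₂ (x y : ℝ) : 0 ≤ ∫ z, rbfTriangle x y z ∂μ :=
    integral_nonneg fun z ↦ rbfTriangle_nonneg x y z
  have h1₂ (x y : ℝ) : ∫ z, rbfTriangle x y z ∂μ ≤ 1 :=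
    integral_le_one_of_nonneg_of_le_one (rbfTriangle_nonneg x y) (rbfTriangle_le_one x y)
  have h0₁ (x : ℝ) : 0 ≤ ∫ y, ∫ z, rbfTriangle x y z ∂μ ∂μ := integral_nonneg (h0₂ x)
  refine mul_measureReal_le_integral (integrable_of_nonneg_of_le_one hm₁ h0₁ fun x ↦
    integral_le_one_of_nonneg_of_le_one (h0₂ x) (h1₂ x)) h0₁ (by positivity) fun x hx ↦ ?_
  have hy (y : ℝ) (hy : y ∈ Set.Icc x (x + 1)) :
      Real.exp (-(3 / 2)) * b ≤ ∫ z, rbfTriangle x y z ∂μ := by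
    refine (mul_le_mul_of_nonneg_left (hA x hx) (by positivity)).trans <|
      mul_measureReal_le_integral (integrable_of_nonneg_of_le_one ?_ (rbfTriangle_nonneg x y)
        (rbfTriangle_le_one x y)) (rbfTriangle_nonneg x y) (by positivity)
        fun z hz ↦ exp_neg_three_halves_le_rbfTriangle hy hz
    exact (continuous_rbfTriangle.comp (by fun_prop : Continuous fun z : ℝ ↦ ((x, y), z))
      ).stronglyMeasurable
  calc Real.exp (-(3 / 2)) * b ^ 2 = Real.exp (-(3 / 2)) * b * b := by ring
    _ ≤ Real.exp (-(3 / 2)) * b * μ.real (Set.Icc x (x + 1)) := by gcongr; exact hA x hx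
    _ ≤ _ := mul_measureReal_le_integral (integrable_of_nonneg_of_le_one
        (hm₂.comp_measurable measurable_prodMk_left) (h0₂ x) (h1₂ x)) (h0₂ x) (by positivity) hy

lemma integrable_exp_neg_sub_sq (y : ℝ) :
    Integrable fun z : ℝ ↦ Real.exp (-(y - z) ^ 2 / 2) := by
  have := (integrable_exp_neg_mul_sq (b := 1 / 2) (by norm_num)).comp_sub_left y
  refine this.congr (.of_forall fun z ↦ ?_)
  simp only
  ring_nf

lemma integral_exp_neg_sub_sq (y : ℝ) :
    ∫ z : ℝ, Real.exp (-(y - z) ^ 2 / 2) = √(2 * Real.pi) := by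
  have h := integral_gaussian (1 / 2)
  rw [← integral_sub_left_eq_self _ volume y] at h
  convert h using 4 <;> ring

lemma integral_exp_neg_sub_sq_le {μ : Measure ℝ} {K : ℝ} (hK : 0 ≤ K)
    (hμ : μ ≤ ENNReal.ofReal K • volume) (y : ℝ) :
    ∫ z, Real.exp (-(y - z) ^ 2 / 2) ∂μ ≤ K * √(2 * Real.pi) := by
  refine (integral_mono_measure hμ (.of_forall fun z ↦ by positivity)
    ((integrable_exp_neg_sub_sq y).smul_measure ENNReal.ofReal_ne_top)).trans_eq ?_
  rw [integral_smul_measure, integral_exp_neg_sub_sq, ENNReal.toReal_ofReal hK, smul_eq_mul]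

/-- Upper bound for the triangle integral of a probability measure with density at most `K`. -/
lemma integral_rbfTriangle_le {μ : Measure ℝ} [IsProbabilityMeasure μ] {K : ℝ} (hK : 0 ≤ K)
    (hμ : μ ≤ ENNReal.ofReal K • volume) :
    ∫ x, ∫ y, ∫ z, rbfTriangle x y z ∂μ ∂μ ∂μ ≤ (K * √(2 * Real.pi)) ^ 2 := by
  have hint (y : ℝ) : Integrable (fun z : ℝ ↦ Real.exp (-(y - z) ^ 2 / 2)) μ :=
    ((integrable_exp_neg_sub_sq y).smul_measure ENNReal.ofReal_ne_top).mono_measure hμ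
  have hz (x y : ℝ) : ∫ z, rbfTriangle x y z ∂μ ≤
      Real.exp (-(x - y) ^ 2 / 2) * (K * √(2 * Real.pi)) := by
    calc _ ≤ ∫ z, Real.exp (-(x - y) ^ 2 / 2) * Real.exp (-(y - z) ^ 2 / 2) ∂μ :=
          integral_mono_of_nonneg (.of_forall (rbfTriangle_nonneg x y)) ((hint y).const_mul _)
            (.of_forall (rbfTriangle_le_mul x y))
      _ ≤ _ := by
          rw [integral_const_mul]
          gcongr
          exact integral_exp_neg_sub_sq_le hK hμ y
  have h0 (x y : ℝ) : 0 ≤ ∫ z, rbfTriangle x y z ∂μ := integral_nonneg (rbfTriangle_nonneg x y)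
  have hy (x : ℝ) : ∫ y, ∫ z, rbfTriangle x y z ∂μ ∂μ ≤ (K * √(2 * Real.pi)) ^ 2 := by
    calc _ ≤ ∫ y, Real.exp (-(x - y) ^ 2 / 2) * (K * √(2 * Real.pi)) ∂μ :=
          integral_mono_of_nonneg (.of_forall (h0 x)) ((hint x).mul_const _) (.of_forall (hz x))
      _ ≤ _ := by
          rw [integral_mul_const, sq]
          gcongr
          exact integral_exp_neg_sub_sq_le hK hμ x
  simpa using integral_mono_of_nonneg (μ := μ) (.of_forall fun x ↦ integral_nonneg (h0 x))
    (integrable_const _) (.of_forall hy)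

lemma gaussianPDFReal_zero_sq {σ : ℝ} (hσ : 0 < σ) (x : ℝ) :
    gaussianPDFReal 0 (σ ^ 2).toNNReal x =
      (√(2 * Real.pi))⁻¹ / σ * Real.exp (-x ^ 2 / (2 * σ ^ 2)) := by
  rw [gaussianPDFReal, Real.coe_toNNReal _ (by positivity), Real.sqrt_mul (by positivity),
    Real.sqrt_sq hσ.le, mul_inv, sub_zero, div_eq_mul_inv _ σ]

lemma toNNReal_sq_ne_zero {σ : ℝ} (hσ : 0 < σ) : (σ ^ 2).toNNReal ≠ 0 :=
  (Real.toNNReal_pos.2 (by positivity)).ne'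

lemma gaussianReal_le_smul_volume {σ : ℝ} (hσ : 0 < σ) :
    gaussianReal 0 (σ ^ 2).toNNReal ≤ ENNReal.ofReal ((√(2 * Real.pi))⁻¹ / σ) • volume := by
  rw [gaussianReal_of_var_ne_zero _ (toNNReal_sq_ne_zero hσ), ← withDensity_const]
  refine withDensity_mono (.of_forall fun x ↦ ENNReal.ofReal_le_ofReal ?_)
  rw [gaussianPDFReal_zero_sq hσ]
  exact mul_le_of_le_one_right (by positivity) (Real.exp_le_one_iff.2 <|
    div_nonpos_of_nonpos_of_nonneg (by nlinarith [sq_nonneg x]) (by positivity))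

/-- Within two standard deviations the density of a centred Gaussian is at least `e⁻²` times its
maximum. -/
lemma mul_sub_le_gaussianReal_Icc {σ a b : ℝ} (hσ : 0 < σ) (ha : -(2 * σ) ≤ a)
    (hb : b ≤ 2 * σ) :
    (√(2 * Real.pi))⁻¹ * Real.exp (-2) / σ * (b - a) ≤
      (gaussianReal 0 (σ ^ 2).toNNReal).real (Set.Icc a b) := by
  rw [measureReal_def, ← ENNReal.ofReal_le_iff_le_toReal (measure_ne_top _ _),
    gaussianReal_apply _ (toNNReal_sq_ne_zero hσ), ENNReal.ofReal_mul (by positivity),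
    ← Real.volume_Icc, ← setLIntegral_const]
  refine setLIntegral_mono (measurable_gaussianPDF _ _) fun x hx ↦ ENNReal.ofReal_le_ofReal ?_
  rw [gaussianPDFReal_zero_sq hσ, mul_div_right_comm]
  gcongr
  rw [le_div_iff₀ (by positivity)]
  nlinarith [mul_nonneg (sub_nonneg.2 (ha.trans hx.1)) (sub_nonneg.2 (hx.2.trans hb))]

lemma exp_neg_two_le_gaussianReal_Icc_sq {σ : ℝ} (hσ : 2 ≤ σ) :
    4 * ((√(2 * Real.pi))⁻¹ * Real.exp (-2)) ≤
      (gaussianReal 0 (σ ^ 2).toNNReal).real (Set.Icc (-σ ^ 2) (σ ^ 2)) := by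
  have hσ0 : 0 < σ := by linarith
  calc _ = (√(2 * Real.pi))⁻¹ * Real.exp (-2) / σ * (2 * σ - -(2 * σ)) := by field_simp; ring
    _ ≤ (gaussianReal 0 (σ ^ 2).toNNReal).real (Set.Icc (-(2 * σ)) (2 * σ)) :=
        mul_sub_le_gaussianReal_Icc hσ0 le_rfl le_rfl
    _ ≤ _ := measureReal_mono (Set.Icc_subset_Icc (by nlinarith) (by nlinarith))

lemma gaussianReal_Icc_sq_ne_zero {σ : ℝ} (hσ : 2 ≤ σ) :
    gaussianReal 0 (σ ^ 2).toNNReal (Set.Icc (-σ ^ 2) (σ ^ 2)) ≠ 0 := by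
  intro h
  have := exp_neg_two_le_gaussianReal_Icc_sq hσ
  rw [measureReal_def, h, ENNReal.toReal_zero] at this
  exact absurd this (not_le.2 (by positivity))

lemma isProbabilityMeasure_truncGauss {σ : ℝ} (hσ : 2 ≤ σ) :
    IsProbabilityMeasure (truncGauss σ) :=
  cond_isProbabilityMeasure (gaussianReal_Icc_sq_ne_zero hσ)

lemma truncGauss_le_smul_volume {σ : ℝ} (hσ : 2 ≤ σ) :
    truncGauss σ ≤ ENNReal.ofReal (Real.exp 2 / 4 / σ) • volume := by
  have hσ0 : 0 < σ := by linarith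
  have hm := exp_neg_two_le_gaussianReal_Icc_sq hσ
  set G := gaussianReal 0 (σ ^ 2).toNNReal with hG
  have hpos : 0 < G.real (Set.Icc (-σ ^ 2) (σ ^ 2)) := lt_of_lt_of_le (by positivity) hm
  calc truncGauss σ ≤ (G (Set.Icc (-σ ^ 2) (σ ^ 2)))⁻¹ • G := by
        rw [truncGauss, ProbabilityTheory.cond, ← hG]
        gcongr
        exact Measure.restrict_le_self
    _ ≤ (G (Set.Icc (-σ ^ 2) (σ ^ 2)))⁻¹ •
          ENNReal.ofReal ((√(2 * Real.pi))⁻¹ / σ) • volume := by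
        gcongr
        exact gaussianReal_le_smul_volume hσ0
    _ ≤ _ := by
        rw [smul_smul]
        gcongr
        rw [← ofReal_measureReal, ← ENNReal.ofReal_inv_of_pos hpos,
          ← ENNReal.ofReal_mul (by positivity)]
        refine ENNReal.ofReal_le_ofReal ?_
        rw [inv_mul_le_iff₀ hpos]
        refine le_trans (le_of_eq ?_) (mul_le_mul_of_nonneg_right hm (by positivity))
        rw [Real.exp_neg]
        field_simp

lemma mul_sub_le_truncGauss_Icc {σ a b : ℝ} (hσ : 2 ≤ σ) (ha : -(2 * σ) ≤ a)
    (hb : b ≤ 2 * σ) :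
    (√(2 * Real.pi))⁻¹ * Real.exp (-2) / σ * (b - a) ≤ (truncGauss σ).real (Set.Icc a b) := by
  refine (mul_sub_le_gaussianReal_Icc (by linarith) ha hb).trans ?_
  have := isProbabilityMeasure_truncGauss hσ
  refine ENNReal.toReal_mono (measure_ne_top _ _) ?_
  rw [truncGauss, cond_apply measurableSet_Icc, Set.inter_eq_self_of_subset_right
    (Set.Icc_subset_Icc (by nlinarith) (by nlinarith))]
  exact le_mul_of_one_le_left' (ENNReal.one_le_inv.2 prob_le_one)

/-- The triple kernel integral `∫∫∫ f(x,y)f(y,z)f(z,x) dG_σ³`, with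
`f(x,y) = exp(−(x−y)²/2)` and `G_σ` the truncated Gaussian, is `Θ(σ⁻²)` as `σ → ∞`. -/
theorem truncated_gaussian_rbf_triangle_theta :
    ∃ c C σ₀ : ℝ, 0 < c ∧ c ≤ C ∧ ∀ σ : ℝ, σ₀ ≤ σ →
      c * (σ ^ 2)⁻¹ ≤ (∫ x, ∫ y, ∫ z,
          Real.exp (-(x - y) ^ 2 / 2) * Real.exp (-(y - z) ^ 2 / 2) *
            Real.exp (-(z - x) ^ 2 / 2)
          ∂(truncGauss σ) ∂(truncGauss σ) ∂(truncGauss σ)) ∧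
      (∫ x, ∫ y, ∫ z,
          Real.exp (-(x - y) ^ 2 / 2) * Real.exp (-(y - z) ^ 2 / 2) *
            Real.exp (-(z - x) ^ 2 / 2)
          ∂(truncGauss σ) ∂(truncGauss σ) ∂(truncGauss σ)) ≤ C * (σ ^ 2)⁻¹ := by
  set k : ℝ := (√(2 * Real.pi))⁻¹ * Real.exp (-2)
  have hk0 : 0 < k := by positivity
  have key (σ : ℝ) (hσ : 2 ≤ σ) :
      2 * Real.exp (-(3 / 2)) * k ^ 3 * (σ ^ 2)⁻¹ ≤
        (∫ x, ∫ y, ∫ z, rbfTriangle x y z ∂(truncGauss σ) ∂(truncGauss σ) ∂(truncGauss σ)) ∧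
      (∫ x, ∫ y, ∫ z, rbfTriangle x y z ∂(truncGauss σ) ∂(truncGauss σ) ∂(truncGauss σ)) ≤
        (Real.exp 2 / 4 * √(2 * Real.pi)) ^ 2 * (σ ^ 2)⁻¹ := by
    have hσ0 : 0 < σ := by linarith
    have := isProbabilityMeasure_truncGauss hσ
    constructor
    · have hA : ∀ x ∈ Set.Icc (-σ) σ, k / σ ≤ (truncGauss σ).real (Set.Icc x (x + 1)) := by
        rintro x ⟨hx0, hx1⟩
        calc k / σ = k / σ * (x + 1 - x) := by ring
          _ ≤ _ := mul_sub_le_truncGauss_Icc hσ (by linarith) (by linarith)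
      refine le_trans ?_ (le_integral_rbfTriangle (by positivity) hA)
      calc 2 * Real.exp (-(3 / 2)) * k ^ 3 * (σ ^ 2)⁻¹
          = Real.exp (-(3 / 2)) * (k / σ) ^ 2 * (k / σ * (σ - -σ)) := by field_simp; ring
        _ ≤ _ := by
          gcongr
          exact mul_sub_le_truncGauss_Icc hσ (by linarith) (by linarith)
    · refine (integral_rbfTriangle_le (by positivity) (truncGauss_le_smul_volume hσ)).trans_eq ?_
      field_simp
  refine ⟨2 * Real.exp (-(3 / 2)) * k ^ 3, (Real.exp 2 / 4 * √(2 * Real.pi)) ^ 2, 2,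
    by positivity, ?_, key⟩
  have h := key 2 le_rfl
  exact le_of_mul_le_mul_right (h.1.trans h.2) (by norm_num)
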